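/- Let T ∈ R(V). Then T^⊥ is a symmetric (0,2)-tensor completely orthogonal to u, T^{⊥∥} belongs to Λ^{(1,2)}(V) and is completely orthogonal to u, T^{∥u} belongs to R(V) and is completely orthogonal to u, and the decomposition T = T^{∥u} + ε (u ⊛ T^{⊥∥}) + T^⊥ ∧ η holds. -/

import Mathlib

open scoped BigOperators

noncomputable section

namespace Decomp

abbrev Vec (n : ℕ) := Fin n → ℝ
abbrev Ten2 (n : ℕ) := Fin n → Fin n → ℝ
abbrev Ten3 (n : ℕ) := Fin n → Fin n → Fin n → ℝ
abbrev Ten4 (n : ℕ) := Fin n → Fin n → Fin n → Fin n → ℝ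

variable {n : ℕ}

/-- A (0,4)-tensor with the algebraic symmetries of a Riemann tensor. -/
def IsRiemannType (T : Ten4 n) : Prop :=
  (∀ α β μ ν, T α β μ ν = - T α β ν μ) ∧
  (∀ α β μ ν, T α β μ ν = - T β α μ ν) ∧
  (∀ α β μ ν, T α β μ ν = T μ ν α β) ∧
  (∀ α β μ ν, T α β μ ν + T α μ ν β + T α ν β μ = 0)

/-- A (0,3)-tensor antisymmetric in the last two indices with vanishing cyclic sum. -/
def IsLambda12 (F : Ten3 n) : Prop :=
  (∀ α μ ν, F α μ ν = - F α ν μ) ∧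
  (∀ α μ ν, F α μ ν + F μ ν α + F ν α μ = 0)

def IsSym2 (S : Ten2 n) : Prop := ∀ α β, S α β = S β α

/-- Ricci-type trace of a (0,4)-tensor (first and third indices, using the inverse metric). -/
def RicT (ginv : Ten2 n) (T : Ten4 n) : Ten2 n :=
  fun β ν => ∑ α, ∑ μ, ginv α μ * T α β μ ν

/-- Scalar-type trace. -/
def ScalT (ginv : Ten2 n) (T : Ten4 n) : ℝ :=
  ∑ β, ∑ ν, ginv β ν * RicT ginv T β ν

/-- Weyl-type: Riemann-type and trace-free in the first and third indices. -/
def IsWeylType (ginv : Ten2 n) (T : Ten4 n) : Prop :=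
  IsRiemannType T ∧ ∀ β ν, RicT ginv T β ν = 0

/-- Kulkarni–Nomizu product. -/
def KN (A B : Ten2 n) : Ten4 n := fun α β μ ν =>
  A α μ * B β ν - A α ν * B β μ - A β μ * B α ν + A β ν * B α μ

/-- (u ⊛ F) for a one-form w and F ∈ Λ^{(1,2)}. -/
def circ (w : Vec n) (F : Ten3 n) : Ten4 n := fun α β μ ν =>
  w α * F β μ ν - w β * F α μ ν + w μ * F ν α β - w ν * F μ α β

/-- Lower an index with the metric. -/
def lower (g : Ten2 n) (u : Vec n) : Vec n := fun α => ∑ β, g α β * u β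

/-- Projector orthogonal to `u`, both indices covariant: γ_{αβ} = g_{αβ} − ε u_α u_β. -/
def gam (g : Ten2 n) (ε : ℝ) (u : Vec n) : Ten2 n := fun α β =>
  g α β - ε * lower g u α * lower g u β

/-- Mixed projector γ^κ_μ = δ^κ_μ − ε u^κ u_μ. -/
def gamMix (g : Ten2 n) (ε : ℝ) (u : Vec n) : Ten2 n := fun κ μ =>
  (if κ = μ then (1 : ℝ) else 0) - ε * u κ * lower g u μ

/-- Contravariant projector γ^{αβ} = g^{αβ} − ε u^α u^β. -/
def gamUp (ginv : Ten2 n) (ε : ℝ) (u : Vec n) : Ten2 n := fun α β =>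
  ginv α β - ε * u α * u β

/-- η := u⊗u − (ε/(n−3)) γ. -/
def eta (g : Ten2 n) (ε : ℝ) (u : Vec n) : Ten2 n := fun α β =>
  lower g u α * lower g u β - (ε / ((n : ℝ) - 3)) * gam g ε u α β

/-- T^⊥_{βν} := u^α u^μ T_{αβμν}. -/
def perp (u : Vec n) (T : Ten4 n) : Ten2 n := fun β ν =>
  ∑ α, ∑ μ, u α * u μ * T α β μ ν

/-- T^{⊥∥}_{βμν} := u^α γ^κ_μ γ^σ_ν T_{αβκσ}. -/
def perppar (g : Ten2 n) (ε : ℝ) (u : Vec n) (T : Ten4 n) : Ten3 n := fun β μ ν =>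
  ∑ α, ∑ κ, ∑ σ, u α * gamMix g ε u κ μ * gamMix g ε u σ ν * T α β κ σ

/-- T^∥ : projection of T with γ in all four indices. -/
def par4 (g : Ten2 n) (ε : ℝ) (u : Vec n) (T : Ten4 n) : Ten4 n := fun α β μ ν =>
  ∑ ρ, ∑ σ, ∑ κ, ∑ δ,
    gamMix g ε u ρ α * gamMix g ε u σ β * gamMix g ε u κ μ * gamMix g ε u δ ν * T ρ σ κ δ

/-- T^{∥u} := T^∥ + (ε/(n−3)) T^⊥ ∧ γ. -/
def parU (g : Ten2 n) (ε : ℝ) (u : Vec n) (T : Ten4 n) : Ten4 n := fun α β μ ν =>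
  par4 g ε u T α β μ ν + (ε / ((n : ℝ) - 3)) * KN (perp u T) (gam g ε u) α β μ ν

/-- Complete orthogonality to `u` for (0,2)-tensors. -/
def Orth2 (u : Vec n) (S : Ten2 n) : Prop :=
  (∀ β, (∑ α, u α * S α β) = 0) ∧ (∀ β, (∑ α, u α * S β α) = 0)

/-- Complete orthogonality to `u` for (0,3)-tensors. -/
def Orth3 (u : Vec n) (F : Ten3 n) : Prop :=
  (∀ μ ν, (∑ α, u α * F α μ ν) = 0) ∧ (∀ μ ν, (∑ α, u α * F μ α ν) = 0) ∧
    (∀ μ ν, (∑ α, u α * F μ ν α) = 0)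

/-- Complete orthogonality to `u` for (0,4)-tensors. -/
def Orth4 (u : Vec n) (T : Ten4 n) : Prop :=
  (∀ β μ ν, (∑ α, u α * T α β μ ν) = 0) ∧ (∀ β μ ν, (∑ α, u α * T β α μ ν) = 0) ∧
    (∀ β μ ν, (∑ α, u α * T β μ α ν) = 0) ∧ (∀ β μ ν, (∑ α, u α * T β μ ν α) = 0)

/-- tr_γ of a (0,2)-tensor. -/
def trGam (ginv : Ten2 n) (ε : ℝ) (u : Vec n) (S : Ten2 n) : ℝ :=
  ∑ α, ∑ β, gamUp ginv ε u α β * S α β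

/-- Schouten-type tensor of a (0,4)-tensor. -/
def SchT (g ginv : Ten2 n) (T : Ten4 n) : Ten2 n := fun β ν =>
  (1 / ((n : ℝ) - 2)) * (RicT ginv T β ν - ScalT ginv T / (2 * ((n : ℝ) - 1)) * g β ν)

/-- Weyl-type part of a (0,4)-tensor: Weyl(T) := T − Sch(T) ∧ g. -/
def WeylT (g ginv : Ten2 n) (T : Ten4 n) : Ten4 n := fun α β μ ν =>
  T α β μ ν - KN (SchT g ginv T) g α β μ ν

/-- Sch_u for Riemann-type tensors completely orthogonal to u. -/
def SchU (g ginv : Ten2 n) (ε : ℝ) (u : Vec n) (P : Ten4 n) : Ten2 n := fun β ν =>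
  (1 / ((n : ℝ) - 3)) * (RicT ginv P β ν - ScalT ginv P / (2 * ((n : ℝ) - 2)) * gam g ε u β ν)

/-- Weyl_u for Riemann-type tensors completely orthogonal to u. -/
def WeylU (g ginv : Ten2 n) (ε : ℝ) (u : Vec n) (P : Ten4 n) : Ten4 n := fun α β μ ν =>
  P α β μ ν - KN (SchU g ginv ε u P) (gam g ε u) α β μ ν

/-- Z_tr := tr_γ T^⊥. -/
def Ztr (ginv : Ten2 n) (ε : ℝ) (u : Vec n) (T : Ten4 n) : ℝ :=
  trGam ginv ε u (perp u T)

/-- γ-trace-free part of an orthogonal symmetric (0,2)-tensor. -/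
def hat2 (g ginv : Ten2 n) (ε : ℝ) (u : Vec n) (S : Ten2 n) : Ten2 n := fun β ν =>
  S β ν - trGam ginv ε u S / ((n : ℝ) - 1) * gam g ε u β ν

/-- T̂^⊥ := T^⊥ − (Z_tr/(n−1)) γ. -/
def hatPerp (g ginv : Ten2 n) (ε : ℝ) (u : Vec n) (T : Ten4 n) : Ten2 n :=
  hat2 g ginv ε u (perp u T)

/-- (V_tr)_μ := γ^{αβ} T^{⊥∥}_{αβμ}. -/
def Vtr (g ginv : Ten2 n) (ε : ℝ) (u : Vec n) (T : Ten4 n) : Vec n := fun μ =>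
  ∑ α, ∑ β, gamUp ginv ε u α β * perppar g ε u T α β μ

/-- T̂^{⊥∥}_{αβμ} := T^{⊥∥}_{αβμ} + (1/(n−2))(−γ_{αβ}(V_tr)_μ + γ_{αμ}(V_tr)_β). -/
def hatPerppar (g ginv : Ten2 n) (ε : ℝ) (u : Vec n) (T : Ten4 n) : Ten3 n := fun α β μ =>
  perppar g ε u T α β μ + (1 / ((n : ℝ) - 2)) *
    (- gam g ε u α β * Vtr g ginv ε u T μ + gam g ε u α μ * Vtr g ginv ε u T β)

/-- S^∥_{βν} := γ^ρ_β γ^κ_ν S_{ρκ}. -/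
def s2par (g : Ten2 n) (ε : ℝ) (u : Vec n) (S : Ten2 n) : Ten2 n := fun β ν =>
  ∑ ρ, ∑ κ, gamMix g ε u ρ β * gamMix g ε u κ ν * S ρ κ

/-- S^{⊥∥}_β := γ^ρ_β u^κ S_{ρκ}. -/
def s2perppar (g : Ten2 n) (ε : ℝ) (u : Vec n) (S : Ten2 n) : Vec n := fun β =>
  ∑ ρ, ∑ κ, gamMix g ε u ρ β * u κ * S ρ κ

/-- S^⊥ := u^ρ u^κ S_{ρκ}. -/
def s2perp (u : Vec n) (S : Ten2 n) : ℝ := ∑ ρ, ∑ κ, u ρ * u κ * S ρ κ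

/-- σ^{(2)}_{βν} := σ_{βρ} σ^ρ{}_ν. -/
def sq (ginv : Ten2 n) (σ : Ten2 n) : Ten2 n := fun β ν =>
  ∑ ρ, ∑ κ, σ β ρ * ginv ρ κ * σ κ ν

/-- Mixed projector h^μ_{μ'} = γ^μ_{μ'} + ε y^μ y_{μ'} orthogonal to span{u,y}. -/
def hMix (g : Ten2 n) (ε : ℝ) (u y : Vec n) : Ten2 n := fun μ μ' =>
  gamMix g ε u μ μ' + ε * y μ * lower g y μ'

/-- Covariant projector h_{αβ} = γ_{αβ} + ε y_α y_β. -/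
def hCov (g : Ten2 n) (ε : ℝ) (u y : Vec n) : Ten2 n := fun α β =>
  gam g ε u α β + ε * lower g y α * lower g y β

/-- g is a symmetric nondegenerate bilinear form with (symmetric) inverse ginv. -/
def GoodMetric (g ginv : Ten2 n) : Prop :=
  (∀ α β, g α β = g β α) ∧ (∀ α β, ginv α β = ginv β α) ∧
    (∀ α β, (∑ μ, ginv α μ * g μ β) = if α = β then (1 : ℝ) else 0) ∧
    (∀ α β, (∑ μ, g α μ * ginv μ β) = if α = β then (1 : ℝ) else 0)

/-- u is a unit vector with g(u,u) = ε ∈ {−1,1}. -/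
def UnitVec (g : Ten2 n) (ε : ℝ) (u : Vec n) : Prop :=
  (ε = 1 ∨ ε = -1) ∧ (∑ α, ∑ β, g α β * u α * u β) = ε


/-- Contraction of the first slot of a (0,4)-tensor with `u`. -/
def contractFirst (u : Vec n) (T : Ten4 n) : Ten3 n := fun β μ ν => ∑ α, u α * T α β μ ν

theorem sum_mul_lower {g : Ten2 n} {ε : ℝ} {u : Vec n} (hu : UnitVec g ε u) :
    ∑ α, u α * lower g u α = ε := by
  rw [← hu.2]
  simp only [lower, Finset.mul_sum]
  exact Finset.sum_congr rfl fun α _ => Finset.sum_congr rfl fun β _ => by ring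

theorem UnitVec.sq_eq_one {g : Ten2 n} {ε : ℝ} {u : Vec n} (hu : UnitVec g ε u) :
    ε * ε = 1 := by
  rcases hu.1 with h | h <;> norm_num [h]

theorem gam_symm {g : Ten2 n} (hg : ∀ α β, g α β = g β α) (ε : ℝ) (u : Vec n) :
    IsSym2 (gam g ε u) := fun α β => by
  simp only [gam]
  rw [hg α β]
  ring

theorem sum_mul_gam {g : Ten2 n} (hg : ∀ α β, g α β = g β α) {ε : ℝ} {u : Vec n}
    (hu : UnitVec g ε u) (β : Fin n) : ∑ α, u α * gam g ε u α β = 0 := by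
  have h : ∑ α, u α * gam g ε u α β
      = lower g u β - ε * lower g u β * ∑ α, u α * lower g u α := by
    conv_rhs => enter [1]; unfold lower
    rw [Finset.mul_sum, ← Finset.sum_sub_distrib]
    refine Finset.sum_congr rfl fun α _ => ?_
    simp only [gam]
    rw [hg α β]
    ring
  rw [h, sum_mul_lower hu]
  linear_combination (-lower g u β) * hu.sq_eq_one

theorem sum_gamMix_mul (g : Ten2 n) (ε : ℝ) (u X : Vec n) (μ : Fin n) :
    ∑ κ, gamMix g ε u κ μ * X κ = X μ - ε * lower g u μ * ∑ κ, u κ * X κ := by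
  simp only [gamMix, sub_mul, Finset.sum_sub_distrib, ite_mul, one_mul, zero_mul,
    Finset.sum_ite_eq', Finset.mem_univ, if_true, Finset.mul_sum]
  congr 1
  exact Finset.sum_congr rfl fun κ _ => by ring

/-- The Kulkarni–Nomizu product of symmetric tensors is of Riemann type. -/
theorem KN_isRiemannType {A B : Ten2 n} (hA : IsSym2 A) (hB : IsSym2 B) :
    IsRiemannType (KN A B) := by
  refine ⟨fun α β μ ν => ?_, fun α β μ ν => ?_, fun α β μ ν => ?_, fun α β μ ν => ?_⟩ <;>
    simp only [KN]
  · ring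
  · ring
  · rw [hA μ α, hB ν β, hA μ β, hB ν α, hA ν α, hB μ β, hA ν β, hB μ α]
    ring
  · rw [hA ν μ, hB ν μ, hA ν β, hB ν β, hA μ β, hB μ β]
    ring

theorem IsRiemannType.add_smul {S T : Ten4 n} (hS : IsRiemannType S) (hT : IsRiemannType T)
    (c : ℝ) : IsRiemannType fun α β μ ν => S α β μ ν + c * T α β μ ν := by
  obtain ⟨a1, a2, a3, a4⟩ := hS
  obtain ⟨b1, b2, b3, b4⟩ := hT
  refine ⟨fun α β μ ν => ?_, fun α β μ ν => ?_, fun α β μ ν => ?_, fun α β μ ν => ?_⟩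
  · linear_combination a1 α β μ ν + c * b1 α β μ ν
  · linear_combination a2 α β μ ν + c * b2 α β μ ν
  · linear_combination a3 α β μ ν + c * b3 α β μ ν
  · linear_combination a4 α β μ ν + c * b4 α β μ ν

/-- For Riemann-type tensors, orthogonality in the first slot implies it in all slots. -/
theorem IsRiemannType.orth4 {T : Ten4 n} (hT : IsRiemannType T) {u : Vec n}
    (h : ∀ β μ ν, ∑ α, u α * T α β μ ν = 0) : Orth4 u T := by
  obtain ⟨h1, h2, h3, -⟩ := hT
  refine ⟨h, fun β μ ν => ?_, fun β μ ν => ?_, fun β μ ν => ?_⟩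
  · simp only [h2 β, mul_neg, Finset.sum_neg_distrib, h, neg_zero]
  · simp only [h3 β μ, h]
  · simp only [h3 β μ, h2 ν, mul_neg, Finset.sum_neg_distrib, h, neg_zero]

theorem perp_eq (u : Vec n) (T : Ten4 n) (β ν : Fin n) :
    perp u T β ν = ∑ μ, u μ * contractFirst u T β μ ν := by
  simp only [perp, contractFirst, Finset.mul_sum]
  rw [Finset.sum_comm]
  exact Finset.sum_congr rfl fun μ _ => Finset.sum_congr rfl fun α _ => by ring

theorem IsRiemannType.perp_symm {T : Ten4 n} (hT : IsRiemannType T) (u : Vec n) :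
    IsSym2 (perp u T) := fun β ν => by
  simp only [perp]
  rw [Finset.sum_comm]
  refine Finset.sum_congr rfl fun μ _ => Finset.sum_congr rfl fun α _ => ?_
  rw [hT.2.2.1 α β μ ν]
  ring

theorem IsRiemannType.contractFirst_isLambda12 {T : Ten4 n} (hT : IsRiemannType T)
    (u : Vec n) : IsLambda12 (contractFirst u T) := by
  refine ⟨fun α μ ν => ?_, fun α μ ν => ?_⟩
  · simp only [contractFirst, ← Finset.sum_neg_distrib]
    exact Finset.sum_congr rfl fun ρ _ => by rw [hT.1 ρ α μ ν, mul_neg]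
  · simp only [contractFirst, ← Finset.sum_add_distrib]
    exact Finset.sum_eq_zero fun ρ _ => by linear_combination u ρ * hT.2.2.2 ρ α μ ν

theorem IsRiemannType.sum_mul_contractFirst {T : Ten4 n} (hT : IsRiemannType T)
    (u : Vec n) (μ ν : Fin n) : ∑ α, u α * contractFirst u T α μ ν = 0 := by
  have h : ∑ α, u α * contractFirst u T α μ ν = -∑ α, u α * contractFirst u T α μ ν := by
    simp only [contractFirst, Finset.mul_sum]
    conv_lhs => rw [Finset.sum_comm]
    simp only [← Finset.sum_neg_distrib]
    refine Finset.sum_congr rfl fun α _ => Finset.sum_congr rfl fun β _ => ?_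
    rw [hT.2.1 α β μ ν]
    ring
  linarith

theorem IsRiemannType.sum_mul_contractFirst_right {T : Ten4 n} (hT : IsRiemannType T)
    (u : Vec n) (β μ : Fin n) : ∑ ν, u ν * contractFirst u T β μ ν = -perp u T β μ := by
  rw [perp_eq, ← Finset.sum_neg_distrib]
  refine Finset.sum_congr rfl fun ν _ => ?_
  rw [(hT.contractFirst_isLambda12 u).1 β μ ν, mul_neg]

theorem IsRiemannType.sum_mul_perp {T : Ten4 n} (hT : IsRiemannType T)
    (u : Vec n) (ν : Fin n) : ∑ β, u β * perp u T β ν = 0 := by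
  simp only [perp_eq, Finset.mul_sum]
  rw [Finset.sum_comm]
  refine Finset.sum_eq_zero fun μ _ => ?_
  have h := congrArg (u μ * ·) (hT.sum_mul_contractFirst u μ ν)
  simp only [Finset.mul_sum, mul_zero] at h
  rw [← h]
  exact Finset.sum_congr rfl fun β _ => by ring

theorem IsRiemannType.perp_orth {T : Ten4 n} (hT : IsRiemannType T) (u : Vec n) :
    Orth2 u (perp u T) :=
  ⟨hT.sum_mul_perp u, fun β => by simpa only [hT.perp_symm u β] using hT.sum_mul_perp u β⟩

theorem IsRiemannType.sum_mul_slot {T : Ten4 n} (hT : IsRiemannType T) (u : Vec n) :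
    (∀ α μ ν, ∑ β, u β * T α β μ ν = -contractFirst u T α μ ν) ∧
      (∀ α β ν, ∑ μ, u μ * T α β μ ν = contractFirst u T ν α β) ∧
      ∀ α β μ, ∑ ν, u ν * T α β μ ν = -contractFirst u T μ α β := by
  obtain ⟨-, h2, h3, -⟩ := hT
  refine ⟨fun α μ ν => ?_, fun α β ν => ?_, fun α β μ => ?_⟩
  · simp only [h2 α, mul_neg, Finset.sum_neg_distrib, contractFirst]
  · simp only [h3 α β, contractFirst]
  · simp only [h3 α β, h2 μ, mul_neg, Finset.sum_neg_distrib, contractFirst]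

theorem IsRiemannType.perppar_eq {T : Ten4 n} (hT : IsRiemannType T) (g : Ten2 n) (ε : ℝ)
    (u : Vec n) (β μ ν : Fin n) :
    perppar g ε u T β μ ν = contractFirst u T β μ ν
      - ε * lower g u μ * perp u T β ν + ε * lower g u ν * perp u T β μ := by
  have h : perppar g ε u T β μ ν
      = ∑ κ, gamMix g ε u κ μ * ∑ σ, gamMix g ε u σ ν * contractFirst u T β κ σ := by
    simp only [perppar, contractFirst, Finset.mul_sum]
    rw [Finset.sum_comm]
    refine Finset.sum_congr rfl fun κ _ => ?_
    rw [Finset.sum_comm]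
    exact Finset.sum_congr rfl fun σ _ => Finset.sum_congr rfl fun α _ => by ring
  rw [h]
  simp only [sum_gamMix_mul, hT.sum_mul_contractFirst_right]
  have e : ∑ κ, u κ * (contractFirst u T β κ ν - ε * lower g u ν * -perp u T β κ)
      = perp u T β ν + ε * lower g u ν * ∑ κ, u κ * perp u T β κ := by
    rw [perp_eq u T β ν, Finset.mul_sum, ← Finset.sum_add_distrib]
    exact Finset.sum_congr rfl fun κ _ => by ring
  rw [e, (hT.perp_orth u).2]
  ring

theorem IsRiemannType.perppar_isLambda12 {T : Ten4 n} (hT : IsRiemannType T) (g : Ten2 n)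
    (ε : ℝ) (u : Vec n) : IsLambda12 (perppar g ε u T) := by
  obtain ⟨h1, h2⟩ := hT.contractFirst_isLambda12 u
  have hP := hT.perp_symm u
  refine ⟨fun α μ ν => ?_, fun α μ ν => ?_⟩ <;> simp only [hT.perppar_eq]
  · linear_combination h1 α μ ν
  · rw [hP ν α, hP ν μ, hP μ α]
    linear_combination h2 α μ ν

theorem IsRiemannType.perppar_orth {T : Ten4 n} (hT : IsRiemannType T) {g : Ten2 n} {ε : ℝ}
    {u : Vec n} (hu : UnitVec g ε u) : Orth3 u (perppar g ε u T) := by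
  have hmid : ∀ μ ν, ∑ α, u α * perppar g ε u T μ α ν = 0 := fun μ ν => by
    have e : ∑ α, u α * perppar g ε u T μ α ν
        = perp u T μ ν - ε * perp u T μ ν * ∑ α, u α * lower g u α
          + ε * lower g u ν * ∑ α, u α * perp u T μ α := by
      conv_rhs => enter [1, 1]; rw [perp_eq]
      simp only [Finset.mul_sum, ← Finset.sum_sub_distrib, ← Finset.sum_add_distrib,
        hT.perppar_eq]
      exact Finset.sum_congr rfl fun α _ => by ring
    rw [e, sum_mul_lower hu, (hT.perp_orth u).2]
    linear_combination (-perp u T μ ν) * hu.sq_eq_one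
  refine ⟨fun μ ν => ?_, hmid, fun μ ν => ?_⟩
  · have e : ∑ α, u α * perppar g ε u T α μ ν
        = ∑ α, u α * contractFirst u T α μ ν - ε * lower g u μ * ∑ α, u α * perp u T α ν
          + ε * lower g u ν * ∑ α, u α * perp u T α μ := by
      simp only [Finset.mul_sum, ← Finset.sum_sub_distrib, ← Finset.sum_add_distrib,
        hT.perppar_eq]
      exact Finset.sum_congr rfl fun α _ => by ring
    rw [e, hT.sum_mul_contractFirst, hT.sum_mul_perp, hT.sum_mul_perp]
    ring
  · simp only [(hT.perppar_isLambda12 g ε u).1 μ ν, mul_neg, Finset.sum_neg_distrib, hmid,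
      neg_zero]

theorem par4_eq_iterated (g : Ten2 n) (ε : ℝ) (u : Vec n) (T : Ten4 n) (α β μ ν : Fin n) :
    par4 g ε u T α β μ ν = ∑ ρ, gamMix g ε u ρ α * ∑ σ, gamMix g ε u σ β *
      ∑ κ, gamMix g ε u κ μ * ∑ δ, gamMix g ε u δ ν * T ρ σ κ δ := by
  simp only [par4, Finset.mul_sum, mul_assoc]

theorem sum_mul_gamMix {g : Ten2 n} {ε : ℝ} {u : Vec n} (hu : UnitVec g ε u) (ρ : Fin n) :
    ∑ α, u α * gamMix g ε u ρ α = 0 := by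
  have e : ∑ α, u α * gamMix g ε u ρ α = u ρ - ε * u ρ * ∑ α, u α * lower g u α := by
    simp only [gamMix, mul_sub, Finset.sum_sub_distrib, mul_ite, mul_one, mul_zero,
      Finset.sum_ite_eq, Finset.mem_univ, if_true, Finset.mul_sum]
    congr 1
    exact Finset.sum_congr rfl fun α _ => by ring
  rw [e, sum_mul_lower hu]
  linear_combination (-u ρ) * hu.sq_eq_one

theorem sum_mul_par4 {g : Ten2 n} {ε : ℝ} {u : Vec n} (hu : UnitVec g ε u) (T : Ten4 n)
    (β μ ν : Fin n) : ∑ α, u α * par4 g ε u T α β μ ν = 0 := by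
  have e : ∑ α, u α * par4 g ε u T α β μ ν = ∑ ρ, (∑ α, u α * gamMix g ε u ρ α) *
      ∑ σ, gamMix g ε u σ β * ∑ κ, gamMix g ε u κ μ * ∑ δ, gamMix g ε u δ ν * T ρ σ κ δ := by
    simp only [par4_eq_iterated, Finset.sum_mul]
    rw [Finset.sum_comm]
    refine Finset.sum_congr rfl fun α _ => ?_
    rw [Finset.mul_sum]
    exact Finset.sum_congr rfl fun ρ _ => (mul_assoc _ _ _).symm
  rw [e]
  simp only [sum_mul_gamMix hu, zero_mul, Finset.sum_const_zero]

/-- The projection of a Riemann-type tensor in terms of its contractions with `u`. -/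
theorem IsRiemannType.par4_eq {T : Ten4 n} (hT : IsRiemannType T) {g : Ten2 n} {ε : ℝ}
    {u : Vec n} (hu : UnitVec g ε u) (α β μ ν : Fin n) :
    par4 g ε u T α β μ ν = T α β μ ν - ε * circ (lower g u) (contractFirst u T) α β μ ν
      + KN (perp u T) (fun ρ σ => lower g u ρ * lower g u σ) α β μ ν := by
  obtain ⟨s2, s3, s4⟩ := hT.sum_mul_slot u
  have inner : ∀ ρ σ, ∑ κ, gamMix g ε u κ μ * ∑ δ, gamMix g ε u δ ν * T ρ σ κ δ
      = T ρ σ μ ν + ε * lower g u ν * contractFirst u T μ ρ σ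
        - ε * lower g u μ * contractFirst u T ν ρ σ := fun ρ σ => by
    simp only [sum_gamMix_mul, s4]
    have e : ∑ κ, u κ * (T ρ σ κ ν - ε * lower g u ν * -contractFirst u T κ ρ σ)
        = ∑ κ, u κ * T ρ σ κ ν + ε * lower g u ν * ∑ κ, u κ * contractFirst u T κ ρ σ := by
      rw [Finset.mul_sum, ← Finset.sum_add_distrib]
      exact Finset.sum_congr rfl fun κ _ => by ring
    rw [e, s3, hT.sum_mul_contractFirst]
    ring
  have middle : ∀ ρ, ∑ σ, gamMix g ε u σ β * (T ρ σ μ ν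
        + ε * lower g u ν * contractFirst u T μ ρ σ
        - ε * lower g u μ * contractFirst u T ν ρ σ)
      = T ρ β μ ν + ε * lower g u ν * contractFirst u T μ ρ β
        - ε * lower g u μ * contractFirst u T ν ρ β
        - ε * lower g u β * (-contractFirst u T ρ μ ν - ε * lower g u ν * perp u T μ ρ
          + ε * lower g u μ * perp u T ν ρ) := fun ρ => by
    rw [sum_gamMix_mul]
    have e : ∑ σ, u σ * (T ρ σ μ ν + ε * lower g u ν * contractFirst u T μ ρ σ
          - ε * lower g u μ * contractFirst u T ν ρ σ)
        = ∑ σ, u σ * T ρ σ μ ν + ε * lower g u ν * ∑ σ, u σ * contractFirst u T μ ρ σ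
          - ε * lower g u μ * ∑ σ, u σ * contractFirst u T ν ρ σ := by
      simp only [Finset.mul_sum, ← Finset.sum_sub_distrib, ← Finset.sum_add_distrib]
      exact Finset.sum_congr rfl fun σ _ => by ring
    rw [e, s2, hT.sum_mul_contractFirst_right, hT.sum_mul_contractFirst_right]
    ring
  rw [par4_eq_iterated]
  simp only [inner, middle]
  rw [sum_gamMix_mul]
  have e : ∑ ρ, u ρ * (T ρ β μ ν + ε * lower g u ν * contractFirst u T μ ρ β
        - ε * lower g u μ * contractFirst u T ν ρ β
        - ε * lower g u β * (-contractFirst u T ρ μ ν - ε * lower g u ν * perp u T μ ρ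
          + ε * lower g u μ * perp u T ν ρ))
      = contractFirst u T β μ ν + ε * lower g u ν * perp u T μ β
        - ε * lower g u μ * perp u T ν β
        - ε * lower g u β * (-∑ ρ, u ρ * contractFirst u T ρ μ ν
          - ε * lower g u ν * ∑ ρ, u ρ * perp u T μ ρ
          + ε * lower g u μ * ∑ ρ, u ρ * perp u T ν ρ) := by
    rw [perp_eq u T μ β, perp_eq u T ν β, contractFirst]
    simp only [Finset.mul_sum, ← Finset.sum_sub_distrib, ← Finset.sum_add_distrib,
      ← Finset.sum_neg_distrib]
    exact Finset.sum_congr rfl fun ρ _ => by ring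
  rw [e, hT.sum_mul_contractFirst, (hT.perp_orth u).2, (hT.perp_orth u).2]
  simp only [circ, KN]
  rw [hT.perp_symm u μ β, hT.perp_symm u ν β, hT.perp_symm u μ α, hT.perp_symm u ν α]
  linear_combination (lower g u α * lower g u μ * perp u T β ν
    - lower g u α * lower g u ν * perp u T β μ - lower g u β * lower g u μ * perp u T α ν
    + lower g u β * lower g u ν * perp u T α μ) * hu.sq_eq_one

/-- The product `w ⊛ F` is of Riemann type. -/
theorem circ_isRiemannType (w : Vec n) {F : Ten3 n} (hF : IsLambda12 F) :
    IsRiemannType (circ w F) := by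
  obtain ⟨h1, h2⟩ := hF
  refine ⟨fun α β μ ν => ?_, fun α β μ ν => ?_, fun α β μ ν => ?_, fun α β μ ν => ?_⟩ <;>
    simp only [circ]
  · linear_combination w α * h1 β μ ν - w β * h1 α μ ν
  · linear_combination w μ * h1 ν α β - w ν * h1 μ α β
  · ring
  · linear_combination w α * h2 β μ ν + w β * (h1 μ α ν - h2 α μ ν)
      + w μ * (h1 ν α β - h2 α ν β) + w ν * (h1 β α μ - h2 α β μ)

theorem IsRiemannType.par4_isRiemannType {T : Ten4 n} (hT : IsRiemannType T) {g : Ten2 n}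
    {ε : ℝ} {u : Vec n} (hu : UnitVec g ε u) : IsRiemannType (par4 g ε u T) := by
  have h := (hT.add_smul (circ_isRiemannType (lower g u)
    (hT.contractFirst_isLambda12 u)) (-ε)).add_smul (KN_isRiemannType (hT.perp_symm u)
    (B := fun ρ σ => lower g u ρ * lower g u σ) fun ρ σ => mul_comm _ _) 1
  convert h using 1
  funext α β μ ν
  rw [hT.par4_eq hu]
  ring

theorem sum_mul_KN {A B : Ten2 n} {u : Vec n} (hA : ∀ β, ∑ α, u α * A α β = 0)
    (hB : ∀ β, ∑ α, u α * B α β = 0) (β μ ν : Fin n) :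
    ∑ α, u α * KN A B α β μ ν = 0 := by
  have e : ∑ α, u α * KN A B α β μ ν
      = B β ν * ∑ α, u α * A α μ - B β μ * ∑ α, u α * A α ν
        - A β μ * ∑ α, u α * B α ν + A β ν * ∑ α, u α * B α μ := by
    simp only [Finset.mul_sum, ← Finset.sum_sub_distrib, ← Finset.sum_add_distrib, KN]
    exact Finset.sum_congr rfl fun α _ => by ring
  rw [e, hA, hA, hB, hB]
  ring

/-- Lemma `decom1`, existence part: the canonical decomposition of a
Riemann-type tensor with respect to a non-null unit vector `u`. -/
theorem stmt0 {n : ℕ} (hn : 4 ≤ n) (g ginv : Ten2 n) (hg : GoodMetric g ginv)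
    (ε : ℝ) (u : Vec n) (hu : UnitVec g ε u)
    (T : Ten4 n) (hT : IsRiemannType T) :
    IsSym2 (perp u T) ∧ Orth2 u (perp u T) ∧
      IsLambda12 (perppar g ε u T) ∧ Orth3 u (perppar g ε u T) ∧
      IsRiemannType (parU g ε u T) ∧ Orth4 u (parU g ε u T) ∧
      ∀ α β μ ν, T α β μ ν = parU g ε u T α β μ ν
        + ε * circ (lower g u) (perppar g ε u T) α β μ ν
        + KN (perp u T) (eta g ε u) α β μ ν := by
  have hγ := gam_symm hg.1 ε u
  have hU : IsRiemannType (parU g ε u T) :=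
    (hT.par4_isRiemannType hu).add_smul (KN_isRiemannType (hT.perp_symm u) hγ) _
  refine ⟨hT.perp_symm u, hT.perp_orth u, hT.perppar_isLambda12 g ε u, hT.perppar_orth hu, hU,
    hU.orth4 fun β μ ν => ?_, fun α β μ ν => ?_⟩
  · have e : ∑ α, u α * parU g ε u T α β μ ν = ∑ α, u α * par4 g ε u T α β μ ν
        + ε / ((n : ℝ) - 3) * ∑ α, u α * KN (perp u T) (gam g ε u) α β μ ν := by
      simp only [Finset.mul_sum, ← Finset.sum_add_distrib, parU]
      exact Finset.sum_congr rfl fun α _ => by ring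
    rw [e, sum_mul_par4 hu, sum_mul_KN (hT.sum_mul_perp u) (sum_mul_gam hg.1 hu)]
    ring
  · simp only [parU, hT.par4_eq hu, circ, hT.perppar_eq, KN, eta]
    rw [hT.perp_symm u ν α, hT.perp_symm u ν β, hT.perp_symm u μ α, hT.perp_symm u μ β]
    linear_combination (2 * (lower g u α * lower g u μ * perp u T β ν
      - lower g u α * lower g u ν * perp u T β μ - lower g u β * lower g u μ * perp u T α ν
      + lower g u β * lower g u ν * perp u T α μ)) * hu.sq_eq_one

end Decomp
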